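/- For k = k₁ + ⋯ + k_m, let π be the partition of [k] = {1,…,k} into consecutive blocks J_i of sizes k_i, and let Π_{k₁,…,k_m} be the set of partitions σ of [k] such that every block of σ meets every block of π in at most one element. Then the cardinality of Π_{k₁,…,k_m} equals ∑_{j₂=0}^{k₂} ⋯ ∑_{j_m=0}^{k_m} ∏_{l=2}^{m} C(k_l, j_l) · [k₁!(k₁+j₂)!⋯(k₁+j₂+⋯+j_{m−1})!] / [(k₁+j₂−k₂)!(k₁+j₂+j₃−k₃)!⋯(k₁+j₂+⋯+j_m−k_m)!], where k₁ ≥ k₂ ≥ ⋯ ≥ k_m. -/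

import Mathlib

namespace SM
open Finset

/-- setoids whose classes contain at most one element of each colour -/
def Good {α ι : Type} (c : α → ι) : Type :=
  {r : Setoid α // ∀ x y, r x y → c x = c y → x = y}

instance finSetoid {α : Type} [Finite α] : Finite (Setoid α) :=
  Finite.of_injective (fun r : Setoid α => fun x y => r x y) (by
    intro r s h
    ext x y
    exact iff_of_eq (congrFun (congrFun h x) y))

instance {α ι : Type} [Finite α] (c : α → ι) : Finite (Good c) := by
  unfold Good; infer_instance

noncomputable instance {α ι : Type} [Finite α] (c : α → ι) : Fintype (Good c) := Fintype.ofFinite _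

noncomputable def W {α ι : Type} [Finite α] (c : α → ι) (f : ℕ → ℕ) : ℕ :=
  ∑ r : Good c, f (Nat.card (Quotient r.1))

theorem W_congr {α β ι κ : Type} [Finite α] [Finite β] (c : α → ι) (d : β → κ) (e : α ≃ β)
    (h : ∀ x y, c x = c y ↔ d (e x) = d (e y)) (f : ℕ → ℕ) : W c f = W d f := by
  unfold W
  refine Fintype.sum_equiv (ι := Good c) (κ := Good d)
    { toFun := fun r => (⟨r.1.comap e.symm, fun x y hr hd => ?_⟩ : Good d)
      invFun := fun r => (⟨r.1.comap e, fun x y hr hd => ?_⟩ : Good c)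
      left_inv := fun r => ?_
      right_inv := fun r => ?_ } _ _ ?_
  · exact e.symm.injective (r.2 _ _ hr ((h _ _).2 (by simpa using hd)))
  · exact e.injective (r.2 _ _ hr ((h _ _).1 hd))
  · exact Subtype.ext (Setoid.ext fun x y => by simp [Setoid.comap_rel])
  · exact Subtype.ext (Setoid.ext fun x y => by simp [Setoid.comap_rel])
  · intro r
    congr 1
    apply Nat.card_congr
    refine Quotient.congr e ?_
    intro a b
    change r.1 a b ↔ r.1 (e.symm (e a)) (e.symm (e b))
    simp

def ext {A ι : Type} (B : Type) (c : A → ι) : A ⊕ B → Option ι :=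
  Sum.elim (fun a => some (c a)) (fun _ => none)

open Classical in
noncomputable def phi {A B : Type} (r : Setoid A) (s : Finset B) (e : s ↪ Quotient r) :
    A ⊕ B → Quotient r ⊕ {b // b ∉ s} :=
  Sum.elim (fun a => Sum.inl ⟦a⟧)
    (fun b => if h : b ∈ s then Sum.inl (e ⟨b, h⟩) else Sum.inr ⟨b, h⟩)

theorem phi_surj {A B : Type} (r : Setoid A) (s : Finset B) (e : s ↪ Quotient r) :
    Function.Surjective (phi r s e) := by
  rintro (q | ⟨b, hb⟩)
  · obtain ⟨a, rfl⟩ := Quotient.exists_rep q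
    exact ⟨Sum.inl a, rfl⟩
  · exact ⟨Sum.inr b, by simp [phi, hb]⟩

theorem phi_inl_inl {A B : Type} (r : Setoid A) (s : Finset B) (e : s ↪ Quotient r) (a a' : A) :
    Setoid.ker (phi r s e) (Sum.inl a) (Sum.inl a') ↔ r a a' := by
  simp only [Setoid.ker_def, phi, Sum.elim_inl, Sum.inl.injEq]
  exact Quotient.eq

theorem phi_inl_inr {A B : Type} (r : Setoid A) (s : Finset B) (e : s ↪ Quotient r) (a : A)
    (b : B) : Setoid.ker (phi r s e) (Sum.inl a) (Sum.inr b) ↔ ∃ h : b ∈ s, e ⟨b, h⟩ = ⟦a⟧ := by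
  by_cases h : b ∈ s <;> simp [Setoid.ker_def, phi, h, eq_comm]

theorem phi_inr_inr {A B : Type} (r : Setoid A) (s : Finset B) (e : s ↪ Quotient r)
    (b b' : B) : Setoid.ker (phi r s e) (Sum.inr b) (Sum.inr b') ↔ b = b' := by
  by_cases h : b ∈ s <;> by_cases h' : b' ∈ s <;> simp [Setoid.ker_def, phi, h, h']
  · rintro rfl; exact h' h
  · rintro rfl; exact h h'

noncomputable def Phi {A B ι : Type} (c : A → ι)
    (x : Σ r : Good c, Σ s : Finset B, (s ↪ Quotient r.1)) : Good (ext B c) :=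
  ⟨Setoid.ker (phi x.1.1 x.2.1 x.2.2), by
    rintro (a | b) (a' | b') h hc
    · rw [phi_inl_inl] at h
      rw [x.1.2 _ _ h (by simpa [ext] using hc)]
    · simp [ext] at hc
    · simp [ext] at hc
    · rw [phi_inr_inr] at h
      rw [h]⟩

theorem Phi_bij {A B ι : Type} [Finite B] (c : A → ι) : Function.Bijective (Phi (B := B) c) := by
  constructor
  · rintro ⟨r, s, e⟩ ⟨r', s', e'⟩ h
    have h : Setoid.ker (phi r.1 s e) = Setoid.ker (phi r'.1 s' e') := congrArg Subtype.val h
    have h1 : r = r' := by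
      apply Subtype.ext; ext a a'
      rw [← phi_inl_inl r.1 s e, h, phi_inl_inl]
    subst h1
    have h2 : s = s' := by
      ext b
      have key : ∀ (t : Finset B) (g : t ↪ Quotient r.1),
          (∃ a, Setoid.ker (phi r.1 t g) (Sum.inl a) (Sum.inr b)) ↔ b ∈ t := by
        intro t g
        simp only [phi_inl_inr]
        constructor
        · rintro ⟨a, h, _⟩; exact h
        · intro hb
          obtain ⟨a, ha⟩ := Quotient.exists_rep (g ⟨b, hb⟩)
          exact ⟨a, hb, ha.symm⟩
      rw [← key s e, h, key]
    subst h2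
    have h3 : e = e' := by
      ext ⟨b, hb⟩
      obtain ⟨a, ha⟩ := Quotient.exists_rep (e ⟨b, hb⟩)
      have : Setoid.ker (phi r.1 s e) (Sum.inl a) (Sum.inr b) :=
        (phi_inl_inr _ _ _ _ _).2 ⟨hb, ha.symm⟩
      rw [h, phi_inl_inr] at this
      obtain ⟨_, h4⟩ := this
      rw [h4, ha]
    subst h3
    rfl
  · rintro ⟨r', hr'⟩
    let r : Good c := ⟨r'.comap Sum.inl, fun x y h hc => by
      have := hr' _ _ h (by simpa [ext] using hc)
      simpa using this⟩
    let s : Finset B := (Set.toFinite {b : B | ∃ a : A, r' (Sum.inr b) (Sum.inl a)}).toFinset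
    have hs : ∀ b, b ∈ s ↔ ∃ a : A, r' (Sum.inr b) (Sum.inl a) := by intro b; simp [s]
    choose g hg using fun b : s => (hs b).1 b.2
    have hB : ∀ b b' : B, r' (Sum.inr b) (Sum.inr b') → b = b' := by
      intro b b' h
      simpa using hr' _ _ h rfl
    have hgr : ∀ (b : s) (a : A), (⟦g b⟧ : Quotient r.1) = ⟦a⟧ ↔ r' (Sum.inl a) (Sum.inr b) := by
      intro b a
      rw [Quotient.eq]
      change r' (Sum.inl (g b)) (Sum.inl a) ↔ _
      constructor
      · intro h; exact r'.symm (r'.trans (hg b) h)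
      · intro h; exact r'.symm (r'.trans h (hg b))
    let e : s ↪ Quotient r.1 := ⟨fun b => ⟦g b⟧, by
      intro b b' h
      have h := (hgr _ _).1 h
      exact Subtype.ext (hB _ _ (r'.symm (r'.trans (hg b') h)))⟩
    refine ⟨⟨r, s, e⟩, Subtype.ext ?_⟩
    change Setoid.ker (phi r.1 s e) = r'
    have hab : ∀ a b, Setoid.ker (phi r.1 s e) (Sum.inl a) (Sum.inr b)
        ↔ r' (Sum.inl a) (Sum.inr b) := by
      intro a b
      rw [phi_inl_inr]
      constructor
      · rintro ⟨h, h'⟩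
        exact (hgr ⟨b, h⟩ a).1 h'
      · intro h
        exact ⟨(hs b).2 ⟨a, r'.symm h⟩, (hgr ⟨b, _⟩ a).2 h⟩
    ext x y
    rcases x with a | b <;> rcases y with a' | b'
    · rw [phi_inl_inl]; rfl
    · exact hab _ _
    · rw [Setoid.comm', hab, Setoid.comm']
    · rw [phi_inr_inr]
      exact ⟨fun h => h ▸ r'.refl _, hB _ _⟩

def step (q : ℕ) (f : ℕ → ℕ) (n : ℕ) : ℕ :=
  ∑ j ∈ range (q + 1), q.choose j * n.descFactorial (q - j) * f (n + j)

theorem W_ext {A B ι : Type} [Finite A] [Fintype B] (c : A → ι) (f : ℕ → ℕ) :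
    W (ext B c) f = W c (step (Fintype.card B) f) := by
  classical
  unfold W
  have : ∀ r : Good c, Fintype (Quotient r.1) := fun r => Fintype.ofFinite _
  rw [← (Equiv.ofBijective _ (Phi_bij (B := B) c)).sum_comp, Fintype.sum_sigma]
  refine Finset.sum_congr rfl fun r _ => ?_
  rw [Fintype.sum_sigma]
  have h1 : ∀ (s : Finset B) (e : s ↪ Quotient r.1),
      Nat.card (Quotient ((Equiv.ofBijective _ (Phi_bij (B := B) c)) ⟨r, s, e⟩).1)
        = Nat.card (Quotient r.1) + (Fintype.card B - #s) := by
    intro s e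
    have := Nat.card_congr (Setoid.quotientKerEquivOfSurjective _ (phi_surj r.1 s e))
    refine this.trans ?_
    rw [Nat.card_sum, Nat.card_eq_fintype_card (α := {b // b ∉ s}), Fintype.card_subtype_compl,
      Fintype.card_coe]
  simp only [h1, Finset.sum_const, Finset.card_univ, Fintype.card_embedding_eq, Fintype.card_coe,
    smul_eq_mul]
  rw [← Nat.card_eq_fintype_card]
  have := Finset.sum_powerset_apply_card (x := (univ : Finset B)) (fun p => (Nat.card (Quotient r.1)).descFactorial p *
    f (Nat.card (Quotient r.1) + (Fintype.card B - p)))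
  rw [Finset.powerset_univ] at this
  rw [this, step, ← Finset.sum_range_reflect, Finset.card_univ]
  refine Finset.sum_congr rfl fun j hj => ?_
  have hj : j ≤ Fintype.card B := by simpa [Nat.lt_succ_iff] using hj
  have e1 : Fintype.card B + 1 - 1 - j = Fintype.card B - j := by omega
  have e2 : Fintype.card B - (Fintype.card B - j) = j := by omega
  rw [e1, e2, Nat.choose_symm hj, smul_eq_mul, mul_assoc]

def T (m : ℕ) (k : Fin (m + 1) → ℕ) (f : ℕ → ℕ) : ℕ :=
  ∑ j ∈ Fintype.piFinset (fun i : Fin m => Finset.range (k i.succ + 1)),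
    (∏ l : Fin m, (k l.succ).choose (j l) *
      (k 0 + ∑ i : Fin m, if (i : ℕ) < (l : ℕ) then j i else 0).descFactorial
        (k l.succ - j l)) * f (k 0 + ∑ i, j i)

theorem T_succ (m : ℕ) (k : Fin (m + 2) → ℕ) (f : ℕ → ℕ) :
    T (m + 1) k f = T m (fun i => k i.castSucc) (step (k (Fin.last _)) f) := by
  unfold T step
  simp only [Finset.mul_sum]
  rw [← Finset.sum_product']
  symm
  refine Finset.sum_bij' (fun x _ => Fin.snoc (α := fun _ => ℕ) x.1 x.2)
    (fun j _ => (fun i => j i.castSucc, j (Fin.last _))) ?_ ?_ ?_ ?_ ?_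
  · rintro ⟨j, x⟩ h
    simp only [mem_product, Fintype.mem_piFinset] at h ⊢
    intro i
    refine Fin.lastCases ?_ (fun i => ?_) i
    · simpa using h.2
    · simpa using h.1 i
  · intro j h
    simp only [mem_product, Fintype.mem_piFinset] at h ⊢
    exact ⟨fun i => by simpa using h i.castSucc, by simpa using h (Fin.last _)⟩
  · rintro ⟨j, x⟩ h
    simp
  · intro j h
    exact Fin.snoc_init_self j
  · rintro ⟨j, x⟩ h
    simp only [Fin.prod_univ_castSucc, Fin.sum_univ_castSucc, Fin.snoc_castSucc, Fin.snoc_last,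
      Fin.val_castSucc, Fin.val_last, Fin.succ_last, Fin.castSucc_zero]
    have h1 : ∀ l : Fin m, ¬ (m < (l : ℕ)) := fun l => by omega
    simp only [h1, if_false, add_zero, Fin.is_lt, if_true, lt_irrefl]
    simp only [← Fin.succ_castSucc]
    simp only [mul_assoc, add_assoc]

theorem W_sigma (m : ℕ) (k : Fin (m + 1) → ℕ) (f : ℕ → ℕ) :
    W (Sigma.fst : (Σ i, Fin (k i)) → Fin (m + 1)) f = T m k f := by
  induction m generalizing f with
  | zero =>
    have : ∀ r : Good (Sigma.fst : (Σ i, Fin (k i)) → Fin 1), r = ⟨⊥, fun x y h _ => h⟩ := by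
      intro r
      apply Subtype.ext
      ext x y
      exact ⟨fun h => r.2 _ _ h (by ext; omega), fun h => h ▸ r.1.refl _⟩
    unfold W T
    rw [Fintype.sum_eq_single _ (fun r hr => absurd (this r) hr)]
    have : Nat.card (Quotient (⊥ : Setoid (Σ i, Fin (k i)))) = k 0 := by
      rw [Nat.card_congr (Quotient.congr (ra := ⊥) (rb := Setoid.ker id) (Equiv.refl _) (by intro a b; rfl)),
        Nat.card_congr (Setoid.quotientKerEquivOfSurjective _ Function.surjective_id)]
      simp
    simp [this]
  | succ m ih =>
    rw [T_succ, ← ih, ← Fintype.card_fin (k (Fin.last _)), ← W_ext]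
    symm
    let φ : (Σ i : Fin (m + 1), Fin (k i.castSucc)) ⊕ Fin (k (Fin.last _)) → Σ i, Fin (k i) :=
      Sum.elim (fun x => ⟨x.1.castSucc, x.2⟩) (fun x => ⟨Fin.last _, x⟩)
    have hφ : Function.Bijective φ := by
      constructor
      · rintro (⟨i, x⟩ | x) (⟨j, y⟩ | y) h
        · simp only [φ, Sum.elim_inl, Sigma.mk.injEq, Fin.castSucc_inj] at h
          obtain ⟨rfl, h⟩ := h
          simp_all
        · simp [φ, Fin.castSucc_ne_last] at h
        · have := congrArg Sigma.fst h
          simp [φ, (Fin.castSucc_ne_last _).symm] at this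
        · simpa [φ] using h
      · rintro ⟨i, x⟩
        induction i using Fin.lastCases with
        | last => exact ⟨Sum.inr x, rfl⟩
        | cast i => exact ⟨Sum.inl ⟨i, x⟩, rfl⟩
    refine W_congr _ _ (Equiv.ofBijective φ hφ) ?_ f
    rintro (⟨i, x⟩ | x) (⟨j, y⟩ | y)
    · simp [φ, ext]
    · simp [φ, ext, Fin.castSucc_ne_last]
    · simp [φ, ext, (Fin.castSucc_ne_last _).symm]
    · simp [φ, ext]


theorem card_finpart {N : ℕ} {ι : Type} (c : Fin N → ι) (F : ι → Finset (Fin N))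
    (hF : ∀ a i, a ∈ F i ↔ c a = i) :
    Nat.card {σ : Finpartition (Finset.univ : Finset (Fin N)) |
      ∀ t ∈ σ.parts, ∀ i, (t ∩ F i).card ≤ 1} = Nat.card (Good c) := by
  classical
  have hp : ∀ (σ : Finpartition (Finset.univ : Finset (Fin N))) x y,
      Setoid.ker σ.part x y ↔ x ∈ σ.part y := by
    intro σ x y
    rw [Setoid.ker_def, σ.mem_part_iff_part_eq_part (mem_univ _) (mem_univ _)]
  refine Nat.card_eq_of_bijective
    (fun σ => (⟨Setoid.ker σ.1.part, fun x y h hc => ?_⟩ : Good c)) ⟨?_, ?_⟩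
  · have h1 := σ.2 (σ.1.part y) (σ.1.part_mem.2 (mem_univ _)) (c y)
    rw [Finset.card_le_one] at h1
    exact h1 x (mem_inter.2 ⟨(hp _ _ _).1 h, (hF _ _).2 hc⟩) y
      (mem_inter.2 ⟨σ.1.mem_part (mem_univ _), (hF _ _).2 rfl⟩)
  · rintro ⟨σ, h⟩ ⟨τ, h'⟩ e
    have e : Setoid.ker σ.part = Setoid.ker τ.part := congrArg Subtype.val e
    have e1 : ∀ y, σ.part y = τ.part y := by
      intro y; ext x; rw [← hp, e, hp]
    have key : ∀ (σ : Finpartition (Finset.univ : Finset (Fin N))) t,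
        t ∈ σ.parts ↔ ∃ y, σ.part y = t := by
      intro σ t
      constructor
      · intro ht
        obtain ⟨x, hx⟩ := σ.nonempty_of_mem_parts ht
        exact ⟨x, σ.part_eq_of_mem ht hx⟩
      · rintro ⟨y, rfl⟩
        exact σ.part_mem.2 (mem_univ _)
    apply Subtype.ext
    apply Finpartition.ext
    ext t
    rw [key, key]
    simp only [e1]
  · rintro ⟨r, hr⟩
    have h0 : Setoid.ker (Finpartition.ofSetoid r).part = r := by
      ext x y
      rw [hp, Finpartition.mem_part_ofSetoid_iff_rel, Setoid.comm']
    refine ⟨⟨Finpartition.ofSetoid r, ?_⟩, Subtype.ext h0⟩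
    intro t ht i
    rw [Finset.card_le_one]
    intro x hx y hy
    rw [mem_inter, hF] at hx hy
    apply hr
    · rw [← h0, hp, Finpartition.part_eq_of_mem _ ht hy.1]
      exact hx.1
    · rw [hx.2, hy.2]

theorem sum_lt {m : ℕ} (k : Fin m → ℕ) (i : Fin m) :
    ∑ i' : Fin (i : ℕ), k (Fin.castLE i.2.le i') = ∑ i' : Fin m, if i' < i then k i' else 0 := by
  rw [← Finset.sum_filter]
  refine Finset.sum_bij (fun a _ => Fin.castLE i.2.le a) ?_ ?_ ?_ ?_
  · intro a _
    exact mem_filter.2 ⟨mem_univ _, Fin.lt_def.2 a.2⟩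
  · intro a _ b _ h
    simpa using h
  · intro b hb
    have hb : b < i := by simpa using hb
    exact ⟨⟨b, hb⟩, mem_univ _, rfl⟩
  · intro a _; rfl

theorem sum_lt_step {m : ℕ} (k : Fin m → ℕ) (i j : Fin m) (h : i < j) :
    (∑ i' : Fin m, if i' < i then k i' else 0) + k i ≤ ∑ i' : Fin m, if i' < j then k i' else 0 := by
  have : k i = ∑ i' : Fin m, if i' = i then k i' else 0 := by simp
  rw [this, ← Finset.sum_add_distrib]
  refine Finset.sum_le_sum fun a _ => ?_
  by_cases h1 : a < i
  · simp [h1, h1.ne, h1.trans h]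
  · by_cases h2 : a = i
    · simp [h2, h]
    · simp [h1, h2]

theorem color {m : ℕ} (k : Fin m → ℕ) (a : Fin (∑ i, k i)) (i : Fin m) :
    a ∈ (Finset.univ.filter fun a : Fin (∑ i, k i) =>
            (∑ i' : Fin m, if i' < i then k i' else 0) ≤ (a : ℕ) ∧
              (a : ℕ) < (∑ i' : Fin m, if i' < i then k i' else 0) + k i) ↔
      (finSigmaFinEquiv.symm a).1 = i := by
  obtain ⟨⟨i0, x⟩, rfl⟩ := finSigmaFinEquiv.surjective a
  rw [Finset.mem_filter, finSigmaFinEquiv_apply, Equiv.symm_apply_apply, sum_lt]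
  have hx := x.2
  dsimp only
  simp only [mem_univ, true_and]
  constructor
  · rintro ⟨h1, h2⟩
    rcases lt_trichotomy i0 i with h | h | h
    · have := sum_lt_step k _ _ h; omega
    · exact h
    · have := sum_lt_step k _ _ h; omega
  · rintro rfl
    omega

end SM

/-- Cardinality of the set `Π_{k₁,…,k_m}` of partitions of `{1,…,k₁+⋯+k_m}` whose blocks
meet each consecutive block `J_i` (of size `k_i`) in at most one element:
`|Π_{k₁,…,k_m}| = ∑_{j₂=0}^{k₂}⋯∑_{j_m=0}^{k_m} ∏_{l=2}^m C(k_l,j_l) ·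
  k₁!(k₁+j₂)!⋯(k₁+j₂+⋯+j_{m−1})! / ((k₁+j₂−k₂)!⋯(k₁+j₂+⋯+j_m−k_m)!)`.
Here the blocks are indexed by `Fin (m+1)` (so there are `m+1` of them), `k 0 = k₁`,
and the sizes are nonincreasing and positive. -/
theorem card_semiMatching_partitions (m : ℕ) (k : Fin (m + 1) → ℕ)
    (hpos : ∀ i, 0 < k i) (hmono : ∀ i j : Fin (m + 1), i ≤ j → k j ≤ k i) :
    (Nat.card
      {σ : Finpartition (Finset.univ : Finset (Fin (∑ i, k i))) |
        ∀ t ∈ σ.parts, ∀ i : Fin (m + 1),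
          (t ∩ (Finset.univ.filter fun a : Fin (∑ i, k i) =>
            (∑ i' : Fin (m + 1), if i' < i then k i' else 0) ≤ (a : ℕ) ∧
              (a : ℕ) < (∑ i' : Fin (m + 1), if i' < i then k i' else 0) + k i)).card ≤ 1} : ℝ)
    =
      ∑ j ∈ Fintype.piFinset (fun i : Fin m => Finset.range (k i.succ + 1)),
        (∏ l : Fin m, ((k l.succ).choose (j l) : ℝ)) *
          (∏ l : Fin m,
              ((k 0 + ∑ i : Fin m, if (i : ℕ) < (l : ℕ) then j i else 0).factorial : ℝ)) /
            (∏ l : Fin m,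
              (((k 0 + ∑ i : Fin m, if (i : ℕ) < (l : ℕ) + 1 then j i else 0)
                  - k l.succ).factorial : ℝ)) := by
  classical
  rw [SM.card_finpart (fun a => (finSigmaFinEquiv.symm a).1) _ (fun a i => SM.color k a i)]
  have h1 : Nat.card (SM.Good fun a : Fin (∑ i, k i) => (finSigmaFinEquiv.symm a).1)
      = SM.T m k (fun _ => 1) := by
    rw [← SM.W_sigma, ← SM.W_congr _ _ finSigmaFinEquiv.symm (fun x y => Iff.rfl), SM.W]
    simp [Nat.card_eq_fintype_card]
  rw [h1, SM.T]
  push_cast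
  refine Finset.sum_congr rfl fun j hj => ?_
  rw [Fintype.mem_piFinset] at hj
  rw [mul_one, Finset.prod_mul_distrib, mul_div_assoc, ← Finset.prod_div_distrib]
  congr 1
  refine Finset.prod_congr rfl fun l _ => ?_
  have hl : j l ≤ k l.succ := by simpa [Nat.lt_succ_iff] using hj l
  have hk : k l.succ ≤ k 0 := hmono _ _ (Fin.zero_le _)
  have hs : (∑ i : Fin m, if (i : ℕ) < (l : ℕ) + 1 then j i else 0)
      = (∑ i : Fin m, if (i : ℕ) < (l : ℕ) then j i else 0) + j l := by
    have : j l = ∑ i : Fin m, if i = l then j i else 0 := by simp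
    rw [this, ← Finset.sum_add_distrib]
    refine Finset.sum_congr rfl fun i _ => ?_
    simp only [Fin.ext_iff]
    split_ifs <;> omega
  rw [hs]
  generalize (∑ i : Fin m, if (i : ℕ) < (l : ℕ) then j i else 0) = n
  have e1 : k 0 + (n + j l) - k l.succ = k 0 + n - (k l.succ - j l) := by omega
  rw [e1, eq_div_iff (by positivity)]
  rw [mul_comm]
  exact_mod_cast Nat.factorial_mul_descFactorial (by omega : k l.succ - j l ≤ k 0 + n)
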